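/- Let U ⊆ ℂⁿ be open and let ρ : ℂⁿ → ℝ be C² on U with −e^{−4} < ρ(x) < 0 for all x ∈ U. Define σ : ℂⁿ → ℝ by σ(x) := 1 / Real.log (−ρ(x)). Then for every x ∈ U and v ∈ ℂⁿ: L_σ(x)(v) ≥ (σ(x)² / (−ρ(x))) · ( L_ρ(x)(v) + (1 / (−2ρ(x))) · ‖∂ρ(x)(v)‖² ). -/

import Mathlib

open Complex

/-- The (1,0)-differential of a real-valued function `f` on `ℂⁿ` at `x` in
direction `v`: `∂f(x)(v) = (1/2)·(Df(x)(v) − i·Df(x)(i·v))`. -/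
noncomputable def delForm {n : ℕ} (f : EuclideanSpace ℂ (Fin n) → ℝ)
    (x v : EuclideanSpace ℂ (Fin n)) : ℂ :=
  (1 / 2 : ℂ) * ((fderiv ℝ f x v : ℂ) - Complex.I * (fderiv ℝ f x (Complex.I • v) : ℂ))

/-- The Levi form of a real-valued function `f` on `ℂⁿ` at `x` in direction `v`:
`L_f(x)(v) = (1/4)·(D²f(x)(v,v) + D²f(x)(i·v,i·v))`. -/
noncomputable def leviForm {n : ℕ} (f : EuclideanSpace ℂ (Fin n) → ℝ)
    (x v : EuclideanSpace ℂ (Fin n)) : ℝ :=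
  (1 / 4) * (fderiv ℝ (fderiv ℝ f) x v v
    + fderiv ℝ (fderiv ℝ f) x (Complex.I • v) (Complex.I • v))

open Filter Topology in
/-- The second-order chain rule for the composition of a function of one real variable with a
real-valued function on a normed space. -/
theorem fderiv_fderiv_real_comp {E : Type*} [NormedAddCommGroup E] [NormedSpace ℝ E]
    {f : E → ℝ} {x : E} {φ φ' : ℝ → ℝ} {c : ℝ} (hf : ContDiffAt ℝ 2 f x)
    (hφ : ∀ᶠ t in 𝓝 (f x), HasDerivAt φ (φ' t) t) (hφ' : HasDerivAt φ' c (f x)) (v w : E) :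
    fderiv ℝ (fderiv ℝ fun y => φ (f y)) x v w
      = φ' (f x) * fderiv ℝ (fderiv ℝ f) x v w + c * (fderiv ℝ f x v * fderiv ℝ f x w) := by
  have hfderiv : (fderiv ℝ fun y => φ (f y)) =ᶠ[𝓝 x] fun y => φ' (f y) • fderiv ℝ f y := by
    filter_upwards [hf.eventually (by simp), hf.continuousAt.eventually hφ] with y hy hφy
    exact (hφy.comp_hasFDerivAt y (hy.differentiableAt (by simp)).hasFDerivAt).fderiv
  have hf₁ : HasFDerivAt f (fderiv ℝ f x) x := (hf.differentiableAt (by simp)).hasFDerivAt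
  have hf₂ : HasFDerivAt (fderiv ℝ f) (fderiv ℝ (fderiv ℝ f) x) x :=
    ((hf.fderiv_right (m := 1) (by norm_num)).differentiableAt (by simp)).hasFDerivAt
  have hprod : HasFDerivAt (fun y => φ' (f y) • fderiv ℝ f y)
      (φ' (f x) • fderiv ℝ (fderiv ℝ f) x + (c • fderiv ℝ f x).smulRight (fderiv ℝ f x)) x :=
    (hφ'.comp_hasFDerivAt x hf₁).smul hf₂
  rw [hfderiv.fderiv_eq, hprod.fderiv]
  simp [mul_assoc]

theorem norm_delForm_sq {n : ℕ} (f : EuclideanSpace ℂ (Fin n) → ℝ)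
    (x v : EuclideanSpace ℂ (Fin n)) :
    ‖delForm f x v‖ ^ 2 = (1 / 4) * (fderiv ℝ f x v ^ 2 + fderiv ℝ f x (Complex.I • v) ^ 2) := by
  rw [Complex.sq_norm, delForm, map_mul, Complex.normSq_apply (_ - _)]
  simp
  ring

open Filter Topology in
/-- The Levi form of the composition of a function of one real variable with `f`. -/
theorem leviForm_real_comp {n : ℕ} {f : EuclideanSpace ℂ (Fin n) → ℝ}
    {x : EuclideanSpace ℂ (Fin n)} {φ φ' : ℝ → ℝ} {c : ℝ} (hf : ContDiffAt ℝ 2 f x)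
    (hφ : ∀ᶠ t in 𝓝 (f x), HasDerivAt φ (φ' t) t) (hφ' : HasDerivAt φ' c (f x))
    (v : EuclideanSpace ℂ (Fin n)) :
    leviForm (fun y => φ (f y)) x v = φ' (f x) * leviForm f x v + c * ‖delForm f x v‖ ^ 2 := by
  rw [norm_delForm_sq, leviForm, leviForm, fderiv_fderiv_real_comp hf hφ hφ',
    fderiv_fderiv_real_comp hf hφ hφ']
  ring

theorem hasDerivAt_one_div_log_neg {t : ℝ} (ht : t ≠ 0) (hlog : Real.log (-t) ≠ 0) :
    HasDerivAt (fun s => 1 / Real.log (-s)) ((1 / Real.log (-t)) ^ 2 / (-t)) t := by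
  have h := ((hasDerivAt_neg t).log (neg_ne_zero.mpr ht)).inv hlog
  simp only [one_div]
  refine h.congr_deriv ?_
  field_simp

theorem hasDerivAt_one_div_log_neg_sq_div_neg {t : ℝ} (ht : t ≠ 0) (hlog : Real.log (-t) ≠ 0) :
    HasDerivAt (fun s => (1 / Real.log (-s)) ^ 2 / (-s))
      ((1 / Real.log (-t)) ^ 2 / t ^ 2 * (1 + 2 * (1 / Real.log (-t)))) t := by
  refine (((hasDerivAt_one_div_log_neg ht hlog).pow 2).div (hasDerivAt_neg t)
    (neg_ne_zero.mpr ht)).congr_deriv ?_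
  simp only [Pi.pow_apply, Nat.cast_ofNat, Nat.add_one_sub_one, pow_one]
  field_simp
  ring

/-- For `−e⁻⁴ < ρ < 0` of class C² on an open `U ⊆ ℂⁿ`, the function
`σ = 1/log(−ρ)` satisfies the estimate
`L_σ(x)(v) ≥ (σ²/(−ρ))·( L_ρ(x)(v) + (1/(−2ρ))·‖∂ρ(x)(v)‖² )`. -/
theorem leviForm_one_div_log_neg_ge {n : ℕ}
    (U : Set (EuclideanSpace ℂ (Fin n))) (hU : IsOpen U)
    (ρ : EuclideanSpace ℂ (Fin n) → ℝ) (hρ : ContDiffOn ℝ 2 ρ U)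
    (hbound : ∀ x ∈ U, -Real.exp (-4) < ρ x ∧ ρ x < 0) :
    ∀ x ∈ U, ∀ v,
      leviForm (fun x => 1 / Real.log (-ρ x)) x v
        ≥ ((1 / Real.log (-ρ x)) ^ 2 / (-ρ x)) *
            (leviForm ρ x v + (1 / (-2 * ρ x)) * ‖delForm ρ x v‖ ^ 2) := by
  intro x hx v
  obtain ⟨hlo, hneg⟩ := hbound x hx
  have hlog : ∀ t : ℝ, -Real.exp (-4) < t → t < 0 → Real.log (-t) < -4 := fun t h₁ h₂ =>
    (Real.log_lt_iff_lt_exp (neg_pos.mpr h₂)).mpr (by linarith)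
  have hφ : ∀ᶠ t in nhds (ρ x), HasDerivAt (fun s => 1 / Real.log (-s))
      ((1 / Real.log (-t)) ^ 2 / (-t)) t := by
    filter_upwards [Ioo_mem_nhds hlo hneg] with t ht
    exact hasDerivAt_one_div_log_neg ht.2.ne (by linarith [hlog t ht.1 ht.2])
  have hlogx := hlog _ hlo hneg
  have hφ' := hasDerivAt_one_div_log_neg_sq_div_neg hneg.ne (by linarith : Real.log (-ρ x) ≠ 0)
  rw [leviForm_real_comp (hρ.contDiffAt (hU.mem_nhds hx)) hφ hφ', ge_iff_le, mul_add,
    ← mul_assoc]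
  refine add_le_add le_rfl (mul_le_mul_of_nonneg_right ?_ (sq_nonneg _))
  have hσ : -(1 / 4) ≤ 1 / Real.log (-ρ x) := by
    rw [le_div_iff_of_neg (by linarith)]
    linarith
  calc (1 / Real.log (-ρ x)) ^ 2 / (-ρ x) * (1 / (-2 * ρ x))
      = (1 / Real.log (-ρ x)) ^ 2 / ρ x ^ 2 * (1 / 2) := by field_simp
    _ ≤ _ := by gcongr; linarith
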